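/- arXiv:math/0503029 — 2 statements merged into one kernel-verified Lean document; each statement's English description precedes it below -/
import Mathlib

section
/- For α, β ∈ C(𝒜), in B(𝒜,Λ,χ) one has b^α ⋆ b^β = ((ℓ^{−χ(β,α)} − 1)/(ℓ−1)) b^{α+β} + b_{[{1,2},κ_{α,β}]}, where κ_{α,β}(1) = α and κ_{α,β}(2) = β. Consequently the commutator satisfies [b^α, b^β] = b^α ⋆ b^β − b^β ⋆ b^α = ((ℓ^{−χ(β,α)} − ℓ^{−χ(α,β)})/(ℓ−1)) b^{α+β} (equation (6.20)), and in particular B^{ind}(𝒜,Λ,χ) is closed under the commutator bracket of ⋆. -/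
open Classical Function

noncomputable section

variable {G : Type} [AddCommGroup G] {Λ : Type} [CommRing Λ] [Algebra ℚ Λ]
  {Ω : Type} [CommRing Ω] [Algebra ℚ Ω]

/-- The "positive cone" `C(𝒜) = C̄(𝒜) ∖ {0}` as a subtype of `K(𝒜)`. -/
abbrev Cpos (Cbar : AddSubmonoid G) : Type := {x : G // x ∈ Cbar ∧ x ≠ 0}
theorem sum_mem_ne_zero {Cbar : AddSubmonoid G}
    (hC : ∀ x ∈ Cbar, ∀ y ∈ Cbar, x + y = 0 → x = 0 ∧ y = 0)
    {ι : Type} (s : Finset ι) (f : ι → G) :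
    s.Nonempty → (∀ i ∈ s, f i ∈ Cbar) → (∀ i ∈ s, f i ≠ 0) →
      (∑ i ∈ s, f i) ∈ Cbar ∧ (∑ i ∈ s, f i) ≠ 0 := by
  induction s using Finset.cons_induction with
  | empty => intro hs _ _; simp at hs
  | cons a s ha ih =>
    intro _ h1 h2
    rw [Finset.sum_cons]
    rcases s.eq_empty_or_nonempty with rfl | hs'
    · simpa using ⟨h1 a (by simp), h2 a (by simp)⟩
    · have ihs := ih hs' (fun i hi => h1 i (Finset.mem_cons_of_mem hi))
        (fun i hi => h2 i (Finset.mem_cons_of_mem hi))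
      exact ⟨Cbar.add_mem (h1 a (by simp)) ihs.1,
        fun h0 => h2 a (by simp) ((hC _ (h1 a (by simp)) _ ihs.1 h0).1)⟩
/-- The sum of two elements of the positive cone `C(𝒜)`. -/
def addC {Cbar : AddSubmonoid G}
    (hC : ∀ x ∈ Cbar, ∀ y ∈ Cbar, x + y = 0 → x = 0 ∧ y = 0)
    (α β : Cpos Cbar) : Cpos Cbar :=
  ⟨(α : G) + (β : G), Cbar.add_mem α.2.1 β.2.1,
    fun h => α.2.2 ((hC _ α.2.1 _ β.2.1 h).1)⟩
/-- A representative `(Fin (card m), κ)` of the equivalence class `[I,κ]`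
corresponding to the multiset `m` of elements of `C(𝒜)`. -/
def repF {Cbar : AddSubmonoid G} (m : Multiset (Cpos Cbar)) :
    Fin (Multiset.card m) → Cpos Cbar :=
  fun i => m.toList.get (Fin.cast (Multiset.length_toList m).symm i)
/-- `|Aut(K,μ)|`, the number of bijections `ι : K → K` with `μ ∘ ι = μ`. -/
def autCard {Cbar : AddSubmonoid G} {n : ℕ} (μ : Fin n → Cpos Cbar) : ℕ :=
  Nat.card {σ : Equiv.Perm (Fin n) // μ ∘ σ = μ}
/-- The coefficient of `b_{[K,μ]}` in `b_{[I,κ]} ⋆ b_{[J,λ]}`, as given by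
equation (6.14) of the paper. -/
def coeff614 {Cbar : AddSubmonoid G} (χ : G → G → ℤ) (l u : Λˣ) {a b c : ℕ}
    (κ : Fin a → Cpos Cbar) (lam : Fin b → Cpos Cbar) (μ : Fin c → Cpos Cbar) : Λ :=
  ((u ^ ((c : ℤ) - (a : ℤ) - (b : ℤ)) : Λˣ) : Λ) *
    algebraMap ℚ Λ ((autCard μ : ℚ))⁻¹ *
    ∑ n ∈ Finset.range (a + b + 1),
      algebraMap ℚ Λ ((-1 : ℚ) ^ (n + c) / (n.factorial : ℚ)) *
        ∑ t ∈ Finset.univ.filter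
            (fun t : (Fin a → Fin n) × (Fin b → Fin n) × (Fin n → Fin c) =>
              Function.Surjective (Sum.elim t.1 t.2.1) ∧
              Function.Surjective t.2.2 ∧
              ∀ k : Fin c,
                (μ k : G) =
                  (∑ i ∈ Finset.univ.filter (fun i : Fin a => t.2.2 (t.1 i) = k),
                    ((κ i : G))) +
                  ∑ j ∈ Finset.univ.filter (fun j : Fin b => t.2.2 (t.2.1 j) = k),
                    ((lam j : G))),
          algebraMap ℚ Λ
              (∏ k : Fin c,
                (((Finset.univ.filter (fun x : Fin n => t.2.2 x = k)).card - 1).factorial : ℚ)) *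
            ∏ q ∈ Finset.univ.filter (fun q : Fin a × Fin b => t.1 q.1 = t.2.1 q.2),
              ((l ^ (-χ ((lam q.2 : G)) ((κ q.1 : G))) : Λˣ) : Λ)
/-- The element `μ(k) = κ(η⁻¹(k)) + λ(ζ⁻¹(k))` of `C(𝒜)` determined by a
surjective map `ρ = η ⊔ ζ : I ⊔ J → K`. -/
def targetμ {Cbar : AddSubmonoid G}
    (hC : ∀ x ∈ Cbar, ∀ y ∈ Cbar, x + y = 0 → x = 0 ∧ y = 0)
    {a b c : ℕ} (κ : Fin a → Cpos Cbar) (lam : Fin b → Cpos Cbar)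
    {ρ : Fin a ⊕ Fin b → Fin c} (hρ : Function.Surjective ρ) (k : Fin c) :
    Cpos Cbar :=
  ⟨∑ x ∈ Finset.univ.filter (fun x => ρ x = k),
      Sum.elim (fun i => ((κ i : G))) (fun j => ((lam j : G))) x,
    sum_mem_ne_zero hC (Finset.univ.filter (fun x => ρ x = k))
      (Sum.elim (fun i => ((κ i : G))) (fun j => ((lam j : G))))
      (by obtain ⟨x, hx⟩ := hρ k; exact ⟨x, by simp [hx]⟩)
      (by rintro (i | j) _
          · exact (κ i).2.1
          · exact (lam j).2.1)
      (by rintro (i | j) _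
          · exact (κ i).2.2
          · exact (lam j).2.2)⟩
/-- The finite set of all equivalence classes `[K,μ]` (encoded as multisets) which can
occur in the product `b_{[I,κ]} ⋆ b_{[J,λ]}`. -/
def candidatesB {Cbar : AddSubmonoid G}
    (hC : ∀ x ∈ Cbar, ∀ y ∈ Cbar, x + y = 0 → x = 0 ∧ y = 0)
    {a b : ℕ} (κ : Fin a → Cpos Cbar) (lam : Fin b → Cpos Cbar) :
    Finset (Multiset (Cpos Cbar)) :=
  (Finset.range (a + b + 1)).biUnion fun c =>
    Finset.image
      (fun ρ : {ρ : Fin a ⊕ Fin b → Fin c // Function.Surjective ρ} =>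
        Multiset.map (targetμ hC κ lam ρ.2) Finset.univ.val)
      Finset.univ
/-- The multiplication `⋆` of equation (6.14) on `B(𝒜,Λ,χ)`, the free `Λ`-module with
basis `b_{[I,κ]}` indexed by the equivalence classes `[I,κ]` (equivalently, by finite
multisets of elements of `C(𝒜)`). -/
def mulB {Cbar : AddSubmonoid G} (χ : G → G → ℤ) (l u : Λˣ)
    (hC : ∀ x ∈ Cbar, ∀ y ∈ Cbar, x + y = 0 → x = 0 ∧ y = 0)
    (f g : Multiset (Cpos Cbar) →₀ Λ) : Multiset (Cpos Cbar) →₀ Λ :=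
  f.sum fun m₁ x =>
    g.sum fun m₂ y =>
      ∑ m₃ ∈ candidatesB hC (repF m₁) (repF m₂),
        Finsupp.single m₃ (x * y * coeff614 χ l u (repF m₁) (repF m₂) (repF m₃))
theorem map_repF {Cbar : AddSubmonoid G} (m : Multiset (Cpos Cbar)) :
    Finset.univ.val.map (repF m) = m := by
  rw [Fin.univ_val_map]
  conv_rhs => rw [← Multiset.coe_toList m]
  congr 1
  apply List.ext_get
  · simp
  · intro n h₁ h₂
    simp [repF]

theorem surjective_elim_fin_two_iff (f g : Fin 1 → Fin 2) :
    Function.Surjective (Sum.elim f g) ↔ f 0 ≠ g 0 := by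
  constructor
  · intro h hfg
    obtain ⟨x, hx⟩ := h (1 - f 0)
    have hx' : f 0 = 1 - f 0 := by
      rcases x with i | i <;> rw [Subsingleton.elim i 0] at hx
      · exact hx
      · exact hfg.trans hx
    revert hx'
    generalize f 0 = y
    revert y
    decide
  · intro h y
    by_cases hy : f 0 = y
    · exact ⟨Sum.inl 0, hy⟩
    · refine ⟨Sum.inr 0, ?_⟩
      change g 0 = y
      omega

theorem surjective_fin_two_fin_two_iff (f : Fin 2 → Fin 2) :
    Function.Surjective f ↔ f 0 ≠ f 1 := by
  revert f
  decide

theorem autCard_one {Cbar : AddSubmonoid G} (μ : Fin 1 → Cpos Cbar) : autCard μ = 1 := by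
  have : Subsingleton {σ : Equiv.Perm (Fin 1) // μ ∘ σ = μ} := inferInstance
  have : Nonempty {σ : Equiv.Perm (Fin 1) // μ ∘ σ = μ} := ⟨⟨1, rfl⟩⟩
  exact Nat.card_unique

theorem autCard_two {Cbar : AddSubmonoid G} (μ : Fin 2 → Cpos Cbar) :
    autCard μ = if μ 0 = μ 1 then 2 else 1 := by
  split_ifs with h
  · have hμ : ∀ σ : Equiv.Perm (Fin 2), μ ∘ σ = μ := by
      have hc : ∀ i j, μ i = μ j := by
        intro i j
        fin_cases i <;> fin_cases j <;> simp [h]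
      exact fun σ => funext fun i => hc _ _
    rw [autCard, Nat.card_congr (Equiv.subtypeUnivEquiv hμ), Nat.card_perm]
    simp
  · rw [autCard, Nat.card_eq_one_iff_unique]
    refine ⟨⟨?_⟩, ⟨⟨1, rfl⟩⟩⟩
    have key : ∀ σ : Equiv.Perm (Fin 2), μ ∘ σ = μ → σ = 1 := by
      intro σ hσ
      have h₀ := congrFun hσ 0
      have h₁ : σ = 1 ∨ σ 0 = 1 := by
        clear h₀ hσ
        revert σ
        decide
      rcases h₁ with h₁ | h₁
      · exact h₁
      · rw [Function.comp_apply, h₁] at h₀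
        exact absurd h₀.symm h
    rintro ⟨σ, hσ⟩ ⟨τ, hτ⟩
    exact Subtype.ext ((key σ hσ).trans (key τ hτ).symm)

theorem sum_range_one_add_one_add_one {M : Type*} [AddCommMonoid M] (f : ℕ → M) :
    ∑ n ∈ Finset.range (1 + 1 + 1), f n = f 0 + f 1 + f 2 := by
  simp [Finset.sum_range_succ]

theorem coeff614_one_one_one {Cbar : AddSubmonoid G} (χ : G → G → ℤ) (l u : Λˣ)
    (κ lam μ : Fin 1 → Cpos Cbar) (hμ : (μ 0 : G) = κ 0 + lam 0) :
    coeff614 χ l u κ lam μ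
      = (((l ^ (-χ (lam 0 : G) (κ 0 : G)) : Λˣ) : Λ) - 1) * ((u⁻¹ : Λˣ) : Λ) := by
  have he : Function.Surjective fun _ : Fin 1 ⊕ Fin 1 => (0 : Fin 1) :=
    fun y => ⟨Sum.inl 0, Subsingleton.elim _ _⟩
  have hθ : ∀ θ : Fin 2 → Fin 1, Function.Surjective θ :=
    fun θ y => ⟨0, Subsingleton.elim _ _⟩
  have hθ' : ∀ θ : Fin 1 → Fin 1, Function.Surjective θ :=
    fun θ y => ⟨0, Subsingleton.elim _ _⟩
  have h2 : algebraMap ℚ Λ ((-1) ^ (2 + 1) / 2) * (1 + 1) = -1 := by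
    rw [← map_one (algebraMap ℚ Λ), ← map_add, ← map_mul, ← map_neg]
    norm_num
  rw [coeff614, sum_range_one_add_one_add_one]
  simp only [Finset.sum_filter, Finset.prod_filter, Fintype.sum_prod_type,
    surjective_elim_fin_two_iff, Fintype.prod_prod_type]
  simp only [← (Equiv.funUnique (Fin 1) (Fin 2)).symm.sum_comp, Fin.sum_univ_two,
    Finset.univ_unique, Finset.sum_singleton, Fin.default_eq_zero, Finset.univ_eq_empty,
    Finset.sum_empty, Finset.prod_singleton]
  simp [he, hθ, hθ', hμ, autCard_one, h2]
  ring

theorem coeff614_one_one_two {Cbar : AddSubmonoid G} (χ : G → G → ℤ) (l u : Λˣ)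
    (κ lam : Fin 1 → Cpos Cbar) (μ : Fin 2 → Cpos Cbar)
    (hμ : Finset.univ.val.map μ = {κ 0, lam 0}) :
    coeff614 χ l u κ lam μ = 1 := by
  have hθ : ∀ θ : Fin 1 → Fin 2, ¬ Function.Surjective θ := by
    intro θ h
    simpa using Fintype.card_le_of_surjective θ h
  rw [coeff614, sum_range_one_add_one_add_one]
  simp only [Finset.sum_filter, Finset.prod_filter, Fintype.sum_prod_type,
    surjective_elim_fin_two_iff, Fintype.prod_prod_type]
  simp only [← (Equiv.funUnique (Fin 1) (Fin 2)).symm.sum_comp, Fin.sum_univ_two,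
    Finset.univ_unique, Finset.sum_singleton, Fin.default_eq_zero, Finset.univ_eq_empty,
    Finset.sum_empty, Finset.prod_singleton, ← (finTwoArrowEquiv (Fin 2)).symm.sum_comp,
    Fintype.sum_prod_type, surjective_fin_two_fin_two_iff]
  have hcases : (μ 0 = κ 0 ∧ μ 1 = lam 0) ∨ (μ 0 = lam 0 ∧ μ 1 = κ 0) := by
    have h : ({μ 0, μ 1} : Multiset (Cpos Cbar)) = {κ 0, lam 0} := by
      rw [← hμ]
      rfl
    rcases Multiset.cons_eq_cons.1 h with ⟨h0, h1⟩ | ⟨_, cs, h0, h1⟩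
    · exact Or.inl ⟨h0, Multiset.singleton_inj.1 h1⟩
    · obtain ⟨h2, rfl⟩ := (Multiset.singleton_eq_cons_iff _).1 h0
      exact Or.inr ⟨(Multiset.singleton_inj.1 h1).symm, h2⟩
  have hcard : ∀ p q : Fin 2, p ≠ q → ∀ k : Fin 2,
      (Finset.univ.filter fun x => ![p, q] x = k).card = 1 := by
    intro p q hpq k
    fin_cases p <;> fin_cases q <;> fin_cases k <;> simp_all <;> rfl
  have h2 : algebraMap ℚ Λ ((-1) ^ 4 / 2) * (1 + 1) = 1 := by
    rw [← map_one (algebraMap ℚ Λ), ← map_add, ← map_mul]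
    norm_num
  have h4 : algebraMap ℚ Λ 2⁻¹ * (algebraMap ℚ Λ ((-1) ^ 4 / 2) * (1 + 1 + (1 + 1))) = 1 := by
    rw [← map_one (algebraMap ℚ Λ), ← map_add, ← map_add, ← map_mul, ← map_mul]
    norm_num
  simp [hθ, autCard_two, Fin.forall_fin_two, hcard, Subtype.val_inj]
  by_cases h : κ 0 = lam 0
  · rcases hcases with ⟨h0, h1⟩ | ⟨h0, h1⟩ <;> simp [h0, h1, h, h4]
  · have h' : lam 0 ≠ κ 0 := fun hh => h hh.symm
    rcases hcases with ⟨h0, h1⟩ | ⟨h0, h1⟩ <;> simp [h0, h1, h, h', h2]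

theorem univ_val_map_fin_two {X : Type*} (f : Fin 2 → X) {p q : Fin 2} (hpq : p ≠ q) :
    Finset.univ.val.map f = {f p, f q} := by
  have h : Finset.univ.val.map f = {f 0, f 1} := rfl
  obtain ⟨rfl, rfl⟩ | ⟨rfl, rfl⟩ : (p = 0 ∧ q = 1) ∨ (p = 1 ∧ q = 0) := by omega
  · exact h
  · rw [h, Multiset.pair_comm]

theorem coe_targetμ_one_one {Cbar : AddSubmonoid G}
    (hC : ∀ x ∈ Cbar, ∀ y ∈ Cbar, x + y = 0 → x = 0 ∧ y = 0) {c : ℕ}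
    (κ lam : Fin 1 → Cpos Cbar) {ρ : Fin 1 ⊕ Fin 1 → Fin c} (hρ : Function.Surjective ρ)
    (k : Fin c) :
    (targetμ hC κ lam hρ k : G)
      = (if ρ (Sum.inl 0) = k then (κ 0 : G) else 0)
        + if ρ (Sum.inr 0) = k then (lam 0 : G) else 0 := by
  simp [targetμ, Finset.sum_filter]

theorem map_targetμ_one_one_one {Cbar : AddSubmonoid G}
    (hC : ∀ x ∈ Cbar, ∀ y ∈ Cbar, x + y = 0 → x = 0 ∧ y = 0)
    (κ lam : Fin 1 → Cpos Cbar) {ρ : Fin 1 ⊕ Fin 1 → Fin 1} (hρ : Function.Surjective ρ) :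
    Finset.univ.val.map (targetμ hC κ lam hρ) = {addC hC (κ 0) (lam 0)} := by
  have h : targetμ hC κ lam hρ 0 = addC hC (κ 0) (lam 0) := by
    apply Subtype.ext
    rw [coe_targetμ_one_one, if_pos (Subsingleton.elim _ _), if_pos (Subsingleton.elim _ _), addC]
  rw [← h]
  rfl

theorem map_targetμ_one_one_two {Cbar : AddSubmonoid G}
    (hC : ∀ x ∈ Cbar, ∀ y ∈ Cbar, x + y = 0 → x = 0 ∧ y = 0)
    (κ lam : Fin 1 → Cpos Cbar) {ρ : Fin 1 ⊕ Fin 1 → Fin 2} (hρ : Function.Surjective ρ) :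
    Finset.univ.val.map (targetμ hC κ lam hρ) = {κ 0, lam 0} := by
  have hne : ρ (Sum.inl 0) ≠ ρ (Sum.inr 0) := by
    have h := (surjective_elim_fin_two_iff (ρ ∘ Sum.inl) (ρ ∘ Sum.inr)).1
    rw [Sum.elim_comp_inl_inr] at h
    exact h hρ
  rw [univ_val_map_fin_two _ hne]
  congr 2
  · apply Subtype.ext
    rw [coe_targetμ_one_one, if_pos rfl, if_neg hne.symm, add_zero]
  · apply Subtype.ext
    rw [coe_targetμ_one_one, if_neg hne, if_pos rfl, zero_add]

theorem candidatesB_one_one {Cbar : AddSubmonoid G}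
    (hC : ∀ x ∈ Cbar, ∀ y ∈ Cbar, x + y = 0 → x = 0 ∧ y = 0)
    (κ lam : Fin 1 → Cpos Cbar) :
    candidatesB hC κ lam = {{addC hC (κ 0) (lam 0)}, {κ 0, lam 0}} := by
  have h3 : Finset.range (1 + 1 + 1) = {0, 1, 2} := rfl
  ext m
  simp only [candidatesB, h3, Finset.mem_biUnion, Finset.mem_image, Finset.mem_univ, true_and,
    Finset.mem_insert, Finset.mem_singleton, Subtype.exists, exists_eq_or_imp, exists_eq_left]
  constructor
  · rintro (⟨ρ, -, -⟩ | ⟨ρ, hρ, rfl⟩ | ⟨ρ, hρ, rfl⟩)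
    · exact (ρ (Sum.inl 0)).elim0
    · exact Or.inl (map_targetμ_one_one_one hC κ lam hρ)
    · exact Or.inr (map_targetμ_one_one_two hC κ lam hρ)
  · rintro (rfl | rfl)
    · exact Or.inr (Or.inl ⟨fun _ => 0, fun y => ⟨Sum.inl 0, Subsingleton.elim _ _⟩,
        map_targetμ_one_one_one hC κ lam _⟩)
    · exact Or.inr (Or.inr ⟨Sum.elim (fun _ => 0) (fun _ => 1),
        (surjective_elim_fin_two_iff _ _).2 (by decide), map_targetμ_one_one_two hC κ lam _⟩)

theorem mulB_single_single {Cbar : AddSubmonoid G} (χ : G → G → ℤ) (l u : Λˣ)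
    (hC : ∀ x ∈ Cbar, ∀ y ∈ Cbar, x + y = 0 → x = 0 ∧ y = 0) (α β : Cpos Cbar) :
    mulB χ l u hC (Finsupp.single {α} 1) (Finsupp.single {β} 1)
      = Finsupp.single {addC hC α β}
          ((((l ^ (-χ (β : G) (α : G)) : Λˣ) : Λ) - 1) * ((u⁻¹ : Λˣ) : Λ))
        + Finsupp.single {α, β} 1 := by
  have h1 : ∀ γ : Cpos Cbar, ∀ i : Fin 1, repF {γ} i = γ := by
    intro γ i
    have h := Multiset.mem_map_of_mem (repF {γ}) (Finset.mem_univ_val i)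
    exact Multiset.mem_singleton.1 ((congrArg (repF {γ} i ∈ ·) (map_repF {γ})).mp h)
  have hne : ({addC hC α β} : Multiset (Cpos Cbar)) ≠ {α, β} := fun h => by
    simpa using congrArg Multiset.card h
  have hcand : candidatesB hC (repF {α}) (repF {β}) = {{addC hC α β}, {α, β}} := by
    have h := candidatesB_one_one hC (repF {α}) (repF {β})
    rw [h1, h1] at h
    exact h
  have hc1 : coeff614 χ l u (repF {α}) (repF {β}) (repF {addC hC α β})
      = (((l ^ (-χ (β : G) (α : G)) : Λˣ) : Λ) - 1) * ((u⁻¹ : Λˣ) : Λ) := by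
    have h := coeff614_one_one_one χ l u (repF {α}) (repF {β}) (repF {addC hC α β})
      (by rw [h1, h1, h1, addC])
    rw [h1, h1] at h
    exact h
  have hc2 : coeff614 χ l u (repF {α}) (repF {β}) (repF {α, β}) = 1 := by
    apply coeff614_one_one_two χ l u (repF {α}) (repF {β}) (repF {α, β})
    rw [h1, h1]
    exact map_repF {α, β}
  rw [mulB, Finsupp.sum_single_index (by simp), Finsupp.sum_single_index (by simp), hcand,
    Finset.sum_pair hne, hc1, hc2, one_mul, one_mul, one_mul]

theorem sum_single_mul_coeff614 {Cbar : AddSubmonoid G} (χ : G → G → ℤ) (l u : Λˣ)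
    (hC : ∀ x ∈ Cbar, ∀ y ∈ Cbar, x + y = 0 → x = 0 ∧ y = 0) (m₁ m₂ : Multiset (Cpos Cbar))
    (x y : Λ) :
    ∑ m₃ ∈ candidatesB hC (repF m₁) (repF m₂),
        Finsupp.single m₃ (x * y * coeff614 χ l u (repF m₁) (repF m₂) (repF m₃))
      = (x * y) • mulB χ l u hC (Finsupp.single m₁ 1) (Finsupp.single m₂ 1) := by
  rw [mulB, Finsupp.sum_single_index (by simp), Finsupp.sum_single_index (by simp),
    Finset.smul_sum]
  simp

theorem mulB_sub_mulB_comm {Cbar : AddSubmonoid G} (χ : G → G → ℤ) (l u : Λˣ)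
    (hC : ∀ x ∈ Cbar, ∀ y ∈ Cbar, x + y = 0 → x = 0 ∧ y = 0)
    (f g : Multiset (Cpos Cbar) →₀ Λ) :
    mulB χ l u hC f g - mulB χ l u hC g f
      = f.sum fun m₁ x => g.sum fun m₂ y => (x * y) •
          (mulB χ l u hC (Finsupp.single m₁ 1) (Finsupp.single m₂ 1)
            - mulB χ l u hC (Finsupp.single m₂ 1) (Finsupp.single m₁ 1)) := by
  rw [mulB, mulB, Finsupp.sum_comm g f]
  simp only [sum_single_mul_coeff614, Finsupp.sum, ← Finset.sum_sub_distrib, smul_sub]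
  simp only [mul_comm]

theorem mulB_single_sub_mulB_single {Cbar : AddSubmonoid G} (χ : G → G → ℤ) (l u : Λˣ)
    (hC : ∀ x ∈ Cbar, ∀ y ∈ Cbar, x + y = 0 → x = 0 ∧ y = 0) (α β : Cpos Cbar) :
    mulB χ l u hC (Finsupp.single {α} 1) (Finsupp.single {β} 1)
        - mulB χ l u hC (Finsupp.single {β} 1) (Finsupp.single {α} 1)
      = Finsupp.single {addC hC α β}
          ((((l ^ (-χ (β : G) (α : G)) : Λˣ) : Λ) - ((l ^ (-χ (α : G) (β : G)) : Λˣ) : Λ))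
            * ((u⁻¹ : Λˣ) : Λ)) := by
  have hadd : addC hC β α = addC hC α β := Subtype.ext (add_comm _ _)
  rw [mulB_single_single, mulB_single_single, hadd, Multiset.pair_comm β α,
    add_sub_add_right_eq_sub, ← Finsupp.single_sub]
  congr 1
  ring

theorem statement4
    (Cbar : AddSubmonoid G)
    (hC : ∀ x ∈ Cbar, ∀ y ∈ Cbar, x + y = 0 → x = 0 ∧ y = 0)
    (χ : G → G → ℤ)
    (hχ₁ : ∀ x y z : G, χ (x + y) z = χ x z + χ y z)
    (hχ₂ : ∀ x y z : G, χ x (y + z) = χ x y + χ x z)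
    (l u : Λˣ) (hl : ∀ k : ℕ, 0 < k → IsUnit ((l : Λ) ^ k - 1))
    (hu : (u : Λ) = (l : Λ) - 1) :
    (∀ α β : Cpos Cbar,
      mulB χ l u hC (Finsupp.single {α} 1) (Finsupp.single {β} 1)
        = Finsupp.single {addC hC α β}
            ((((l ^ (-χ (β : G) (α : G)) : Λˣ) : Λ) - 1) * ((u⁻¹ : Λˣ) : Λ))
          + Finsupp.single {α, β} 1) ∧
    (∀ α β : Cpos Cbar,
      mulB χ l u hC (Finsupp.single {α} 1) (Finsupp.single {β} 1)
          - mulB χ l u hC (Finsupp.single {β} 1) (Finsupp.single {α} 1)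
        = Finsupp.single {addC hC α β}
            ((((l ^ (-χ (β : G) (α : G)) : Λˣ) : Λ) - ((l ^ (-χ (α : G) (β : G)) : Λˣ) : Λ))
              * ((u⁻¹ : Λˣ) : Λ))) ∧
    (∀ f g : Multiset (Cpos Cbar) →₀ Λ,
      (∀ m, f m ≠ 0 → Multiset.card m = 1) → (∀ m, g m ≠ 0 → Multiset.card m = 1) →
      ∀ m, (mulB χ l u hC f g - mulB χ l u hC g f) m ≠ 0 → Multiset.card m = 1) := by
  refine ⟨mulB_single_single χ l u hC, mulB_single_sub_mulB_single χ l u hC, ?_⟩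
  intro f g hf hg m hm
  by_contra hcard
  apply hm
  rw [mulB_sub_mulB_comm, Finsupp.sum, Finsupp.finsetSum_apply]
  refine Finset.sum_eq_zero fun m₁ hm₁ => ?_
  rw [Finsupp.sum, Finsupp.finsetSum_apply]
  refine Finset.sum_eq_zero fun m₂ hm₂ => ?_
  obtain ⟨α, rfl⟩ := Multiset.card_eq_one.1 (hf m₁ (Finsupp.mem_support_iff.1 hm₁))
  obtain ⟨β, rfl⟩ := Multiset.card_eq_one.1 (hg m₂ (Finsupp.mem_support_iff.1 hm₂))
  rw [mulB_single_sub_mulB_single, Finsupp.smul_apply, Finsupp.single_eq_of_ne, smul_zero]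
  rintro rfl
  exact hcard (Multiset.card_singleton _)
end
end

section
/- Every structure constant of the multiplication ⋆ of B(𝒜,Λ,χ) with respect to the basis {b_{[I,κ]}} lies in Λ°; consequently B(𝒜,Λ°,χ) is closed under ⋆ and is a Λ°-subalgebra of B(𝒜,Λ,χ) with Λ°-basis {b_{[I,κ]}}, and B^{ind}(𝒜,Λ°,χ) := B^{ind}(𝒜,Λ,χ) ∩ B(𝒜,Λ°,χ) is closed under the commutator bracket and is a Λ°-Lie subalgebra. -/
open Classical Function

noncomputable section

variable {G : Type} [AddCommGroup G] {Λ : Type} [CommRing Λ] [Algebra ℚ Λ]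
  {Ω : Type} [CommRing Ω] [Algebra ℚ Ω]

/-- The weight `∏ₖ (|θ⁻¹(k)| - 1)!` of a map `θ`. -/
def fiberWeight {n c : ℕ} (θ : Fin n → Fin c) : ℚ :=
  ∏ k : Fin c, (((Finset.univ.filter (fun x : Fin n => θ x = k)).card - 1).factorial : ℚ)

/-- The sum of `fiberWeight θ * F p` over all factorizations `ρ = θ ∘ p` through `Fin n` with `p`
surjective. -/
def factorSum {R : Type} [CommRing R] [Algebra ℚ R] {Q : Type} [Fintype Q] {c : ℕ} (ρ : Q → Fin c)
    (n : ℕ) (F : (Q → Fin n) → R) : R :=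
  ∑ t : (Q → Fin n) × (Fin n → Fin c),
    if Function.Surjective t.1 ∧ t.2 ∘ t.1 = ρ then algebraMap ℚ R (fiberWeight t.2) * F t.1 else 0

/-- The alternating sum over `n < M` of the sums `factorSum`, each divided by `n!`. -/
def alternatingSum {R : Type} [CommRing R] [Algebra ℚ R] {Q : Type} [Fintype Q] {c : ℕ}
    (ρ : Q → Fin c) (M : ℕ) (F : ∀ n, (Q → Fin n) → R) : R :=
  ∑ n ∈ Finset.range M,
    algebraMap ℚ R ((-1 : ℚ) ^ (n + c) / (n.factorial : ℚ)) * factorSum ρ n (F n)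

theorem fiberWeight_insertNth {m c : ℕ} (v : Fin (m + 1)) (k : Fin c) (θ : Fin m → Fin c)
    (hk : ∃ x, θ x = k) :
    fiberWeight (v.insertNth k θ : Fin (m + 1) → Fin c) =
      ((Finset.univ.filter (fun x : Fin m => θ x = k)).card : ℚ) * fiberWeight θ := by
  have hcard : ∀ j : Fin c,
      (Finset.univ.filter
        (fun x => (v.insertNth k θ : Fin (m + 1) → Fin c) x = j)).card =
        (if k = j then 1 else 0) + (Finset.univ.filter (fun x : Fin m => θ x = j)).card := by
    intro j
    simp only [Finset.card_filter, Fin.sum_univ_succAbove _ v, Fin.insertNth_apply_same,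
      Fin.insertNth_apply_succAbove]
  have hpos : 0 < (Finset.univ.filter (fun x : Fin m => θ x = k)).card := by
    obtain ⟨x, hx⟩ := hk
    exact Finset.card_pos.2 ⟨x, by simp [hx]⟩
  unfold fiberWeight
  have hprod : ((Finset.univ.filter (fun x : Fin m => θ x = k)).card : ℚ) =
      ∏ j : Fin c,
        if k = j then ((Finset.univ.filter (fun x : Fin m => θ x = j)).card : ℚ) else 1 := by
    simp
  rw [hprod, ← Finset.prod_mul_distrib]
  refine Finset.prod_congr rfl fun j _ => ?_
  rw [hcard]
  by_cases h : k = j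
  · subst h
    simp only [if_true]
    rw [← Nat.cast_mul, Nat.mul_factorial_pred hpos.ne', Nat.add_sub_cancel_left]
  · simp [h]

/-- The sum of `|θ⁻¹(k)| * fiberWeight θ` over all factorizations `ρ = θ ∘ p` through `Fin n` with
`p` surjective. -/
def sharedSum {Q : Type} [Fintype Q] {c : ℕ} (ρ : Q → Fin c) (k : Fin c) (n : ℕ) : ℚ :=
  ∑ t : (Q → Fin n) × (Fin n → Fin c),
    if Function.Surjective t.1 ∧ t.2 ∘ t.1 = ρ then
      ((Finset.univ.filter (fun x : Fin n => t.2 x = k)).card : ℚ) * fiberWeight t.2 else 0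

theorem sum_isolated {Q : Type} [Fintype Q] {c : ℕ} (ρ : Q → Fin c) (k : Fin c)
    (hk : ∃ y, ρ y = k) (m : ℕ) (v : Fin (m + 1)) :
    (∑ t : (Q → Fin (m + 1)) × (Fin (m + 1) → Fin c),
      if (∀ w, w ∈ Set.range t.1 ↔ w ≠ v) ∧ t.2 v = k ∧ t.2 ∘ t.1 = ρ then
        fiberWeight t.2 else 0) = sharedSum ρ k m := by
  symm
  unfold sharedSum
  refine Fintype.sum_of_injective
    (fun t : (Q → Fin m) × (Fin m → Fin c) =>
      ((fun q => v.succAbove (t.1 q) : Q → Fin (m + 1)),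
        (v.insertNth k t.2 : Fin (m + 1) → Fin c))) ?_ _ _ ?_ ?_
  · rintro ⟨p, θ⟩ ⟨p', θ'⟩ h
    simp only [Prod.mk.injEq] at h
    refine Prod.ext (funext fun q => Fin.succAbove_right_injective (congrFun h.1 q))
      (funext fun x => ?_)
    simpa using congrFun h.2 (v.succAbove x)
  · rintro ⟨p, θ⟩ h
    rw [if_neg]
    rintro ⟨h1, h2, -⟩
    apply h
    have hp : ∀ q, ∃ x, v.succAbove x = p q := fun q =>
      Fin.exists_succAbove_eq ((h1 _).1 ⟨q, rfl⟩)
    choose p' hp' using hp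
    refine ⟨(p', fun x => θ (v.succAbove x)), Prod.ext (funext hp') ?_⟩
    simp only at h2
    subst h2
    exact Fin.insertNth_self_removeNth v θ
  · rintro ⟨p, θ⟩
    have hiff : ((∀ w, w ∈ Set.range (fun q => v.succAbove (p q)) ↔ w ≠ v) ∧
        (v.insertNth k θ : Fin (m + 1) → Fin c) v = k ∧
        (v.insertNth k θ : Fin (m + 1) → Fin c) ∘ (fun q => v.succAbove (p q)) = ρ) ↔
        (Function.Surjective p ∧ θ ∘ p = ρ) := by
      have h2 : (v.insertNth k θ : Fin (m + 1) → Fin c) ∘ (fun q => v.succAbove (p q)) =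
          θ ∘ p := by
        funext q; simp
      rw [h2]
      constructor
      · rintro ⟨h1, -, h3⟩
        refine ⟨fun x => ?_, h3⟩
        obtain ⟨q, hq⟩ := (h1 (v.succAbove x)).2 (Fin.succAbove_ne v x)
        exact ⟨q, Fin.succAbove_right_injective hq⟩
      · rintro ⟨h1, h3⟩
        refine ⟨fun w => ⟨?_, fun hw => ?_⟩, by simp, h3⟩
        · rintro ⟨q, rfl⟩
          exact Fin.succAbove_ne v _
        · obtain ⟨x, rfl⟩ := Fin.exists_succAbove_eq hw
          obtain ⟨q, rfl⟩ := h1 x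
          exact ⟨q, rfl⟩
    simp only [hiff]
    split_ifs with h
    · rw [fiberWeight_insertNth]
      obtain ⟨y, hy⟩ := hk
      exact ⟨p y, by rw [← hy, ← h.2]; rfl⟩
    · rfl

theorem surjective_elim_iff {Q : Type} {n : ℕ} (v : Fin n) (p : Q → Fin n) :
    Function.Surjective (fun o : Option Q => o.elim v p) ↔
      Function.Surjective p ∨ ∀ w, w ∈ Set.range p ↔ w ≠ v := by
  constructor
  · intro h
    by_cases hv : v ∈ Set.range p
    · left
      intro w
      obtain ⟨_ | q, hq⟩ := h w
      · obtain rfl : v = w := hq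
        exact hv
      · exact ⟨q, hq⟩
    · right
      refine fun w => ⟨?_, fun hw => ?_⟩
      · rintro hw rfl
        exact hv hw
      · obtain ⟨_ | q, hq⟩ := h w
        · exact absurd hq.symm hw
        · exact ⟨q, hq⟩
  · rintro (h | h) w
    · obtain ⟨q, hq⟩ := h w
      exact ⟨some q, hq⟩
    · by_cases hw : w = v
      · exact ⟨none, hw.symm⟩
      · obtain ⟨q, hq⟩ := (h w).2 hw
        exact ⟨some q, hq⟩

theorem factorSum_option {Q : Type} [Fintype Q] {c : ℕ} (ρ : Option Q → Fin c) (n : ℕ) :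
    factorSum ρ n (fun _ => (1 : ℚ)) = sharedSum (fun q => ρ (some q)) (ρ none) n +
      ∑ v : Fin n, ∑ t : (Q → Fin n) × (Fin n → Fin c),
        if (∀ w, w ∈ Set.range t.1 ↔ w ≠ v) ∧ t.2 v = ρ none ∧ t.2 ∘ t.1 = fun q => ρ (some q)
          then fiberWeight t.2 else 0 := by
  have hshared : sharedSum (fun q => ρ (some q)) (ρ none) n =
      ∑ v : Fin n, ∑ t : (Q → Fin n) × (Fin n → Fin c),
        if Function.Surjective t.1 ∧ t.2 v = ρ none ∧ t.2 ∘ t.1 = fun q => ρ (some q)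
          then fiberWeight t.2 else 0 := by
    rw [Finset.sum_comm]
    unfold sharedSum
    refine Finset.sum_congr rfl fun t _ => ?_
    by_cases h : Function.Surjective t.1 ∧ t.2 ∘ t.1 = fun q => ρ (some q)
    · simp [h.1, h.2, ← Finset.sum_filter]
    · rw [if_neg h]
      refine (Finset.sum_eq_zero fun v _ => if_neg ?_).symm
      tauto
  rw [hshared, ← Finset.sum_add_distrib]
  simp only [← Finset.sum_add_distrib]
  rw [← Fintype.sum_prod_type'
    (f := fun (v : Fin n) (t : (Q → Fin n) × (Fin n → Fin c)) =>
      (if Function.Surjective t.1 ∧ t.2 v = ρ none ∧ t.2 ∘ t.1 = fun q => ρ (some q)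
          then fiberWeight t.2 else 0) +
      if (∀ w, w ∈ Set.range t.1 ↔ w ≠ v) ∧ t.2 v = ρ none ∧ t.2 ∘ t.1 = fun q => ρ (some q)
          then fiberWeight t.2 else 0)]
  unfold factorSum
  symm
  refine Finset.sum_bijective
    (fun s : Fin n × (Q → Fin n) × (Fin n → Fin c) =>
      ((fun o : Option Q => o.elim s.1 s.2.1), s.2.2)) ⟨?_, ?_⟩ (by simp) ?_
  · rintro ⟨v, p, θ⟩ ⟨v', p', θ'⟩ h
    simp only [Prod.mk.injEq] at h
    refine Prod.ext (congrFun h.1 none) (Prod.ext (funext fun q => congrFun h.1 (some q)) h.2)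
  · rintro ⟨p, θ⟩
    refine ⟨(p none, fun q => p (some q), θ), Prod.ext (funext fun o => ?_) rfl⟩
    cases o <;> rfl
  · rintro ⟨v, p, θ⟩ -
    have hcomp : (θ ∘ (fun o : Option Q => o.elim v p) = ρ) ↔
        (θ v = ρ none ∧ θ ∘ p = fun q => ρ (some q)) := by
      constructor
      · rintro rfl
        exact ⟨rfl, rfl⟩
      · rintro ⟨h1, h2⟩
        funext o
        cases o with
        | none => exact h1
        | some q => exact congrFun h2 q
    have hdisj : Function.Surjective p → ¬ ∀ w, w ∈ Set.range p ↔ w ≠ v :=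
      fun h h' => (h' v).1 (h v) rfl
    simp only [surjective_elim_iff, hcomp, Algebra.algebraMap_self, RingHom.id_apply, mul_one]
    by_cases h1 : Function.Surjective p
    · simp only [h1, hdisj h1, true_and, false_and, true_or, if_false, add_zero]
    · simp only [h1, false_and, false_or, if_false, zero_add]

theorem alternatingSum_option {Q : Type} [Fintype Q] {c : ℕ} (ρ : Option Q → Fin c)
    (hk : ∃ y, ρ (some y) = ρ none) (M : ℕ) (hM : Fintype.card Q < M) :
    alternatingSum ρ (M + 1) (fun _ _ => (1 : ℚ)) = 0 := by
  have hstep : ∀ m, factorSum ρ (m + 1) (fun _ => (1 : ℚ)) =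
      sharedSum (fun q => ρ (some q)) (ρ none) (m + 1) +
        (m + 1) * sharedSum (fun q => ρ (some q)) (ρ none) m := by
    intro m
    rw [factorSum_option, Finset.sum_congr rfl fun v _ => sum_isolated _ _ hk m v]
    simp
  have htel : ∀ N, alternatingSum ρ (N + 1) (fun _ _ => (1 : ℚ)) =
      (-1 : ℚ) ^ (N + c) / (N.factorial : ℚ) * sharedSum (fun q => ρ (some q)) (ρ none) N := by
    intro N
    induction N with
    | zero => simp [alternatingSum, factorSum_option]
    | succ N ih =>
      unfold alternatingSum at ih ⊢
      rw [Finset.sum_range_succ, ih, hstep, Nat.factorial_succ]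
      have : ((N.factorial : ℕ) : ℚ) ≠ 0 := by positivity
      have : (N : ℚ) + 1 ≠ 0 := by positivity
      simp only [Algebra.algebraMap_self, RingHom.id_apply]
      push_cast
      field_simp
      ring
  rw [htel]
  have h0 : sharedSum (fun q => ρ (some q)) (ρ none) M = 0 := by
    refine Finset.sum_eq_zero fun t _ => if_neg fun h => ?_
    have := Fintype.card_le_of_surjective _ h.1
    rw [Fintype.card_fin] at this
    omega
  rw [h0, mul_zero]

theorem factorSum_equiv {Q Q' : Type} [Fintype Q] [Fintype Q'] (e : Q' ≃ Q) {c : ℕ}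
    (ρ : Q → Fin c) (n : ℕ) :
    factorSum (ρ ∘ e) n (fun _ => (1 : ℚ)) = factorSum ρ n (fun _ => (1 : ℚ)) := by
  unfold factorSum
  refine Fintype.sum_equiv
    ((Equiv.arrowCongr e (Equiv.refl (Fin n))).prodCongr (Equiv.refl _)) _ _ ?_
  rintro ⟨p, θ⟩
  have h : (θ ∘ p = ρ ∘ e) ↔ (θ ∘ p ∘ e.symm = ρ) := by
    rw [← Function.comp_assoc, Equiv.comp_symm_eq]
  simp [Equiv.arrowCongr, h]

theorem alternatingSum_one_eq_zero {Q : Type} [Fintype Q] {c : ℕ} (ρ : Q → Fin c)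
    (hc : c < Fintype.card Q) (M : ℕ) (hM : Fintype.card Q < M) :
    alternatingSum ρ M (fun _ _ => (1 : ℚ)) = 0 := by
  obtain ⟨x, y, hxy, hρ⟩ := Fintype.exists_ne_map_eq_of_card_lt ρ (by simpa using hc)
  obtain ⟨M, rfl⟩ : ∃ N, M = N + 1 := ⟨M - 1, by omega⟩
  have hcard := Fintype.card_congr (Equiv.optionSubtypeNe x)
  rw [Fintype.card_option] at hcard
  have := alternatingSum_option (ρ ∘ Equiv.optionSubtypeNe x)
    ⟨⟨y, hxy.symm⟩, by simp [hρ]⟩ M (by omega)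
  simpa only [alternatingSum, factorSum_equiv] using this

section Divisibility

variable {R : Type} [CommRing R] [Algebra ℚ R]

theorem factorSum_add {Q : Type} [Fintype Q] {c : ℕ} (ρ : Q → Fin c) (n : ℕ)
    (F F' : (Q → Fin n) → R) :
    factorSum ρ n (fun p => F p + F' p) = factorSum ρ n F + factorSum ρ n F' := by
  simp only [factorSum, ← Finset.sum_add_distrib]
  refine Finset.sum_congr rfl fun t _ => ?_
  split_ifs <;> ring

theorem factorSum_smul {Q : Type} [Fintype Q] {c : ℕ} (ρ : Q → Fin c) (n : ℕ) (r : R)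
    (F : (Q → Fin n) → R) :
    factorSum ρ n (fun p => r * F p) = r * factorSum ρ n F := by
  simp only [factorSum, Finset.mul_sum]
  refine Finset.sum_congr rfl fun t _ => ?_
  split_ifs <;> ring

theorem alternatingSum_add {Q : Type} [Fintype Q] {c : ℕ} (ρ : Q → Fin c) (M : ℕ)
    (F F' : ∀ n, (Q → Fin n) → R) :
    alternatingSum ρ M (fun n p => F n p + F' n p) =
      alternatingSum ρ M F + alternatingSum ρ M F' := by
  simp only [alternatingSum, factorSum_add, mul_add, Finset.sum_add_distrib]

theorem alternatingSum_smul {Q : Type} [Fintype Q] {c : ℕ} (ρ : Q → Fin c) (M : ℕ) (r : R)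
    (F : ∀ n, (Q → Fin n) → R) :
    alternatingSum ρ M (fun n p => r * F n p) = r * alternatingSum ρ M F := by
  simp only [alternatingSum, factorSum_smul, Finset.mul_sum, mul_left_comm]

theorem alternatingSum_algebraMap {Q : Type} [Fintype Q] {c : ℕ} (ρ : Q → Fin c) (M : ℕ) :
    alternatingSum ρ M (fun _ _ => (1 : R)) =
      algebraMap ℚ R (alternatingSum ρ M (fun _ _ => (1 : ℚ))) := by
  simp only [alternatingSum, factorSum, map_sum, map_mul, apply_ite (algebraMap ℚ R), map_zero,
    map_one, Algebra.algebraMap_self, RingHom.id_apply]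

/-- The retraction of `Q` onto `Q ∖ {x}` sending `x` to `y`. -/
def contract {Q : Type} {x y : Q} (hxy : y ≠ x) (z : Q) : {z : Q // z ≠ x} :=
  if h : z = x then ⟨y, hxy⟩ else ⟨z, h⟩

theorem contract_val {Q : Type} {x y : Q} (hxy : y ≠ x) (z : {z : Q // z ≠ x}) :
    contract hxy z = z := by
  simp [contract, z.2]

theorem comp_val_contract {Q S : Type} {x y : Q} (hxy : y ≠ x) (f : Q → S) (hf : f x = f y) :
    (fun z => f (contract hxy z : Q)) = f := by
  funext z
  unfold contract
  split_ifs with h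
  · rw [h, hf]
  · rfl

theorem factorSum_contract {Q : Type} [Fintype Q] {c : ℕ} (ρ : Q → Fin c) {x y : Q} (hxy : y ≠ x)
    (hρ : ρ x = ρ y) (n : ℕ) (F : (Q → Fin n) → R) :
    factorSum ρ n (fun p => if p x = p y then F p else 0) =
      factorSum (fun z : {z : Q // z ≠ x} => ρ z) n (fun p => F (fun z => p (contract hxy z))) := by
  symm
  unfold factorSum
  refine Finset.sum_of_injOn
    (fun t : ({z : Q // z ≠ x} → Fin n) × (Fin n → Fin c) =>
      ((fun z => t.1 (contract hxy z) : Q → Fin n), t.2))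
    (Function.Injective.injOn ?_) (by simp) ?_ ?_
  · rintro ⟨p, θ⟩ ⟨p', θ'⟩ h
    simp only [Prod.mk.injEq] at h
    refine Prod.ext (funext fun z => ?_) h.2
    simpa [contract_val] using congrFun h.1 z
  · rintro ⟨p, θ⟩ - h
    by_cases hp : p x = p y
    · exact absurd ⟨(fun z => p z, θ), by simp, Prod.ext (comp_val_contract hxy p hp) rfl⟩ h
    · simp [hp]
  · rintro ⟨p, θ⟩ -
    have h1 : contract hxy x = contract hxy y := by simp [contract, hxy]
    have h2 : Function.Surjective (fun z => p (contract hxy z)) ↔ Function.Surjective p := by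
      constructor
      · intro h w
        obtain ⟨z, hz⟩ := h w
        exact ⟨_, hz⟩
      · intro h w
        obtain ⟨z, hz⟩ := h w
        exact ⟨z, by simpa only [contract_val] using hz⟩
    have h3 : (θ ∘ p = fun z : {z : Q // z ≠ x} => ρ z) ↔
        (θ ∘ (fun z => p (contract hxy z)) = ρ) := by
      constructor
      · intro h
        rw [← comp_val_contract hxy ρ hρ]
        funext z
        exact congrFun h (contract hxy z)
      · intro h
        funext z
        have := congrFun h z
        simpa only [Function.comp, contract_val] using this
    simp only [h1, h2, h3, if_true]

/-- The product of the weights of those edges of `L` whose end points are identified by `f`. -/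
def edgeWeight {V S : Type} (L : List (V × V × R)) (f : V → S) : R :=
  (L.map fun e => if f e.1 = f e.2.1 then e.2.2 else 1).prod

theorem alternatingSum_edgeWeight {V : Type} {c : ℕ} (A : Subalgebra ℚ R) (h : R) (hA : h ∈ A)
    (L : List (V × V × R)) (hL : ∀ e ∈ L, ∃ r ∈ A, e.2.2 - 1 = h * r) :
    ∀ (Q : Type) [Fintype Q] (f : V → Q) (ρ : Q → Fin c) (M : ℕ), Fintype.card Q < M →
      ∃ r ∈ A, alternatingSum ρ M (fun _ p => edgeWeight L (fun v => p (f v))) =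
        h ^ (Fintype.card Q - c) * r := by
  induction L with
  | nil =>
    intro Q _ f ρ M hM
    simp only [edgeWeight, List.map_nil, List.prod_nil]
    rw [alternatingSum_algebraMap (R := R) ρ M]
    by_cases hc : c < Fintype.card Q
    · exact ⟨0, A.zero_mem, by rw [alternatingSum_one_eq_zero ρ hc M hM, map_zero, mul_zero]⟩
    · refine ⟨algebraMap ℚ R _, A.algebraMap_mem (alternatingSum ρ M fun _ _ => 1), ?_⟩
      rw [Nat.sub_eq_zero_of_le (not_lt.1 hc), pow_zero, one_mul]
  | cons e L ih =>
    intro Q _ f ρ M hM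
    have ih := ih fun e he => hL e (List.mem_cons_of_mem _ he)
    obtain ⟨s, hs, hse⟩ := hL e List.mem_cons_self
    obtain ⟨x, y, w⟩ := e
    simp only at hse
    obtain ⟨r, hr, hrL⟩ := ih Q f ρ M hM
    have hsplit : alternatingSum ρ M (fun _ p => edgeWeight ((x, y, w) :: L) (fun v => p (f v))) =
        alternatingSum ρ M (fun _ p => edgeWeight L (fun v => p (f v))) +
        (w - 1) * alternatingSum ρ M (fun _ p =>
          if p (f x) = p (f y) then edgeWeight L (fun v => p (f v)) else 0) := by
      rw [← alternatingSum_smul, ← alternatingSum_add]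
      congr 1
      funext n p
      simp only [edgeWeight, List.map_cons, List.prod_cons]
      split_ifs <;> ring
    rw [hsplit, hrL, hse]
    by_cases hxy : f y = f x
    · simp only [hxy, if_true, hrL]
      exact ⟨r + h * s * r, A.add_mem hr (A.mul_mem (A.mul_mem hA hs) hr), by ring⟩
    by_cases hρ : ρ (f x) = ρ (f y)
    · obtain ⟨r', hr', hrL'⟩ := ih {z : Q // z ≠ f x} (fun v => contract hxy (f v))
        (fun z => ρ z) M ((Fintype.card_subtype_le _).trans_lt hM)
      have hcontract : alternatingSum ρ M (fun _ p =>
          if p (f x) = p (f y) then edgeWeight L (fun v => p (f v)) else 0) =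
          alternatingSum (fun z : {z : Q // z ≠ f x} => ρ z) M
            (fun _ p => edgeWeight L (fun v => p (contract hxy (f v)))) := by
        unfold alternatingSum
        refine Finset.sum_congr rfl fun n _ => ?_
        rw [factorSum_contract ρ hxy hρ n (fun p => edgeWeight L (fun v => p (f v)))]
      have hcard : Fintype.card {z : Q // z ≠ f x} + 1 = Fintype.card Q := by
        rw [← Fintype.card_option, Fintype.card_congr (Equiv.optionSubtypeNe (f x))]
      obtain ⟨d, hd⟩ : ∃ d, Fintype.card {z : Q // z ≠ f x} - c + 1 = Fintype.card Q - c + d :=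
        ⟨_, (Nat.add_sub_of_le (by omega)).symm⟩
      refine ⟨r + s * (h ^ d * r'),
        A.add_mem hr (A.mul_mem hs (A.mul_mem (A.pow_mem hA d) hr')), ?_⟩
      calc _ = h ^ (Fintype.card Q - c) * r +
            s * (h ^ (Fintype.card {z : Q // z ≠ f x} - c + 1) * r') := by
              rw [hcontract, hrL']; ring
        _ = _ := by rw [hd]; ring
    · refine ⟨r, hr, ?_⟩
      have hzero : alternatingSum ρ M (fun _ p =>
          if p (f x) = p (f y) then edgeWeight L (fun v => p (f v)) else 0) = 0 := by
        refine Finset.sum_eq_zero fun n _ => ?_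
        unfold factorSum
        rw [Finset.sum_eq_zero, mul_zero]
        intro t _
        dsimp only
        split_ifs with h1 h2
        · refine absurd ?_ hρ
          rw [← h1.2, Function.comp, Function.comp, h2]
        · rw [mul_zero]
        · rfl
      rw [hzero, mul_zero, add_zero]

end Divisibility

theorem zpow_sub_one_mem (A : Subalgebra ℚ Λ) (l : Λˣ) (hl : (l : Λ) ∈ A)
    (hl' : ((l⁻¹ : Λˣ) : Λ) ∈ A) (k : ℤ) :
    ∃ r ∈ A, ((l ^ k : Λˣ) : Λ) - 1 = ((l : Λ) - 1) * r := by
  have hnat : ∀ n : ℕ, (l : Λ) ^ n - 1 = ((l : Λ) - 1) * ∑ i ∈ Finset.range n, (l : Λ) ^ i :=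
    fun n => (mul_geom_sum _ n).symm
  have hmem : ∀ n : ℕ, ∑ i ∈ Finset.range n, (l : Λ) ^ i ∈ A :=
    fun n => A.sum_mem fun i _ => A.pow_mem hl i
  obtain ⟨n, rfl | rfl⟩ := k.eq_nat_or_neg
  · refine ⟨_, hmem n, ?_⟩
    rw [zpow_natCast, Units.val_pow_eq_pow_val, hnat]
  · refine ⟨_, A.neg_mem (A.mul_mem (A.pow_mem hl' n) (hmem n)), ?_⟩
    have hinv : ((l⁻¹ : Λˣ) : Λ) ^ n * (l : Λ) ^ n = 1 := by
      rw [← mul_pow, Units.inv_mul, one_pow]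
    rw [zpow_neg, zpow_natCast, ← inv_pow, Units.val_pow_eq_pow_val]
    linear_combination (-((l⁻¹ : Λˣ) : Λ) ^ n) * hnat n + hinv

theorem coeff614_mem {Cbar : AddSubmonoid G} (χ : G → G → ℤ) (l u : Λˣ)
    (hu : (u : Λ) = (l : Λ) - 1) (A : Subalgebra ℚ Λ) (hl : (l : Λ) ∈ A)
    (hl' : ((l⁻¹ : Λˣ) : Λ) ∈ A) {a b c : ℕ} (κ : Fin a → Cpos Cbar)
    (lam : Fin b → Cpos Cbar) (μ : Fin c → Cpos Cbar) : coeff614 χ l u κ lam μ ∈ A := by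
  have huA : (u : Λ) ∈ A := hu ▸ A.sub_mem hl A.one_mem
  set w : Fin a × Fin b → Λ := fun q => ((l ^ (-χ (lam q.2 : G) (κ q.1 : G)) : Λˣ) : Λ)
  set L : List ((Fin a ⊕ Fin b) × (Fin a ⊕ Fin b) × Λ) :=
    (Finset.univ : Finset (Fin a × Fin b)).toList.map
      fun q => (Sum.inl q.1, Sum.inr q.2, w q) with hLdef
  have hL : ∀ e ∈ L, ∃ r ∈ A, e.2.2 - 1 = (u : Λ) * r := by
    intro e he
    obtain ⟨q, -, rfl⟩ := List.mem_map.1 he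
    rw [hu]
    exact zpow_sub_one_mem A l hl hl' _
  have hweight : ∀ n (φ : Fin a → Fin n) (ψ : Fin b → Fin n),
      ∏ q ∈ Finset.univ.filter (fun q : Fin a × Fin b => φ q.1 = ψ q.2), w q =
        edgeWeight L (Sum.elim φ ψ) := by
    intro n φ ψ
    rw [Finset.prod_filter, edgeWeight, hLdef, List.map_map, Finset.prod_map_toList]
    refine Finset.prod_congr rfl fun q _ => ?_
    simp only [Function.comp, Sum.elim_inl, Sum.elim_inr]
    congr
  let P : (Fin a ⊕ Fin b → Fin c) → Prop := fun ρ => Function.Surjective ρ ∧ ∀ k : Fin c,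
    (μ k : G) = (∑ i ∈ Finset.univ.filter (fun i => ρ (Sum.inl i) = k), (κ i : G)) +
      ∑ j ∈ Finset.univ.filter (fun j => ρ (Sum.inr j) = k), (lam j : G)
  have hsum : coeff614 χ l u κ lam μ =
      algebraMap ℚ Λ ((autCard μ : ℚ))⁻¹ * ∑ ρ ∈ Finset.univ.filter P,
        ((u ^ ((c : ℤ) - (a : ℤ) - (b : ℤ)) : Λˣ) : Λ) *
          alternatingSum ρ (a + b + 1) (fun _ p => edgeWeight L p) := by
    rw [← Finset.mul_sum, coeff614, mul_comm (Units.val _), mul_assoc]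
    congr 2
    unfold alternatingSum
    rw [Finset.sum_comm]
    refine Finset.sum_congr rfl fun n _ => ?_
    rw [← Finset.mul_sum]
    congr 1
    unfold factorSum
    rw [Finset.sum_comm, Finset.sum_filter]
    let e : (Fin a → Fin n) × (Fin b → Fin n) × (Fin n → Fin c) ≃
        (Fin a ⊕ Fin b → Fin n) × (Fin n → Fin c) :=
      (Equiv.prodAssoc _ _ _).symm.trans
        ((Equiv.sumArrowEquivProdArrow _ _ _).symm.prodCongr (Equiv.refl _))
    refine Finset.sum_equiv e (by simp) ?_
    rintro ⟨φ, ψ, θ⟩ -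
    have he : e (φ, ψ, θ) = (Sum.elim φ ψ, θ) := rfl
    rw [he]
    simp only
    rw [hweight]
    by_cases hs : Function.Surjective (Sum.elim φ ψ)
    · have hθ : Function.Surjective θ ↔ Function.Surjective (θ ∘ Sum.elim φ ψ) :=
        ⟨fun h => h.comp hs, fun h => h.of_comp⟩
      simp only [hs, true_and, Finset.sum_ite_eq, Finset.mem_filter, Finset.mem_univ, hθ, P,
        fiberWeight, Function.comp, Sum.elim_inl, Sum.elim_inr]
      congr
    · simp [hs]
  rw [hsum]
  refine A.mul_mem (A.algebraMap_mem _) (A.sum_mem fun ρ hρ => ?_)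
  obtain ⟨r, hr, hrL⟩ := alternatingSum_edgeWeight A (u : Λ) huA L hL (Fin a ⊕ Fin b) id ρ
    (a + b + 1) (by simp)
  have hc : c ≤ a + b := by
    have := Fintype.card_le_of_surjective ρ (Finset.mem_filter.1 hρ).2.1
    simpa using this
  simp only [id, Fintype.card_sum, Fintype.card_fin] at hrL
  have hcancel : u ^ ((c : ℤ) - (a : ℤ) - (b : ℤ)) * u ^ (a + b - c) = 1 := by
    rw [← zpow_natCast, ← zpow_add]
    convert zpow_zero u
    omega
  have hcancel' := congrArg Units.val hcancel
  rw [Units.val_mul, Units.val_pow_eq_pow_val, Units.val_one] at hcancel'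
  rw [hrL, ← mul_assoc, hcancel', one_mul]
  exact hr

theorem mulB_apply {Cbar : AddSubmonoid G} (χ : G → G → ℤ) (l u : Λˣ)
    (hC : ∀ x ∈ Cbar, ∀ y ∈ Cbar, x + y = 0 → x = 0 ∧ y = 0)
    (f g : Multiset (Cpos Cbar) →₀ Λ) (m : Multiset (Cpos Cbar)) :
    mulB χ l u hC f g m = ∑ m₁ ∈ f.support, ∑ m₂ ∈ g.support,
      if m ∈ candidatesB hC (repF m₁) (repF m₂) then
        f m₁ * g m₂ * coeff614 χ l u (repF m₁) (repF m₂) (repF m) else 0 := by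
  simp only [mulB, Finsupp.sum, Finsupp.finsetSum_apply]
  refine Finset.sum_congr rfl fun m₁ _ => Finset.sum_congr rfl fun m₂ _ => ?_
  simp only [Finsupp.single_apply, Finset.sum_ite_eq']

theorem mem_candidatesB_swap {Cbar : AddSubmonoid G}
    (hC : ∀ x ∈ Cbar, ∀ y ∈ Cbar, x + y = 0 → x = 0 ∧ y = 0)
    {a b : ℕ} (κ : Fin a → Cpos Cbar) (lam : Fin b → Cpos Cbar) {m : Multiset (Cpos Cbar)}
    (hm : m ∈ candidatesB hC κ lam) : m ∈ candidatesB hC lam κ := by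
  simp only [candidatesB, Finset.mem_biUnion, Finset.mem_range, Finset.mem_image,
    Finset.mem_univ, true_and] at hm ⊢
  obtain ⟨c, hc, ⟨ρ, hρ⟩, rfl⟩ := hm
  refine ⟨c, by omega, ⟨ρ ∘ Sum.swap, hρ.comp Sum.swap_rightInverse.surjective⟩, ?_⟩
  refine Multiset.map_congr rfl fun k _ => Subtype.ext ?_
  simp only [targetμ, Finset.sum_filter]
  refine Fintype.sum_equiv (Equiv.sumComm _ _) _ _ ?_
  rintro (i | j) <;> rfl

theorem mem_candidatesB_comm {Cbar : AddSubmonoid G}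
    (hC : ∀ x ∈ Cbar, ∀ y ∈ Cbar, x + y = 0 → x = 0 ∧ y = 0)
    {a b : ℕ} (κ : Fin a → Cpos Cbar) (lam : Fin b → Cpos Cbar) (m : Multiset (Cpos Cbar)) :
    m ∈ candidatesB hC κ lam ↔ m ∈ candidatesB hC lam κ :=
  ⟨mem_candidatesB_swap hC κ lam, mem_candidatesB_swap hC lam κ⟩

theorem coeff614_comm {Cbar : AddSubmonoid G} (χ : G → G → ℤ) (l u : Λˣ) {a b c : ℕ}
    (ha : a = 1) (hb : b = 1) (hc : c ≠ 1) (κ : Fin a → Cpos Cbar) (lam : Fin b → Cpos Cbar)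
    (μ : Fin c → Cpos Cbar) : coeff614 χ l u κ lam μ = coeff614 χ l u lam κ μ := by
  subst ha hb
  unfold coeff614
  congr 1
  refine Finset.sum_congr rfl fun n _ => ?_
  congr 1
  have hne : ∀ (φ ψ : Fin 1 → Fin n) (θ : Fin n → Fin c),
      Function.Surjective (Sum.elim φ ψ) → Function.Surjective θ → ∀ i j, φ i ≠ ψ j := by
    intro φ ψ θ hs hθ i j hij
    apply hc
    have hconst : ∀ x, θ x = θ (φ i) := by
      intro x
      obtain ⟨i' | j', rfl⟩ := hs x
      · rw [Subsingleton.elim i i']; rfl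
      · rw [hij, Subsingleton.elim j j']; rfl
    have hcard : Fintype.card (Fin c) = 1 :=
      Fintype.card_eq_one_iff.2
        ⟨θ (φ i), fun k => by obtain ⟨x, rfl⟩ := hθ k; exact hconst x⟩
    rwa [Fintype.card_fin] at hcard
  simp only [Finset.sum_filter]
  let e : (Fin 1 → Fin n) × (Fin 1 → Fin n) × (Fin n → Fin c) ≃
      (Fin 1 → Fin n) × (Fin 1 → Fin n) × (Fin n → Fin c) :=
    ⟨fun t => (t.2.1, t.1, t.2.2), fun t => (t.2.1, t.1, t.2.2), fun _ => rfl, fun _ => rfl⟩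
  refine Fintype.sum_equiv e _ _ ?_
  rintro ⟨φ, ψ, θ⟩
  have hsurj : Function.Surjective (Sum.elim φ ψ) ↔ Function.Surjective (Sum.elim ψ φ) := by
    simp only [Function.Surjective, Sum.exists, Sum.elim_inl, Sum.elim_inr, or_comm]
  simp only [e, Equiv.coe_fn_mk, hsurj]
  by_cases h : Function.Surjective (Sum.elim ψ φ) ∧ Function.Surjective θ
  · have hne' := hne ψ φ θ h.1 h.2
    simp only [h.1, h.2, true_and, hne', (hne' _ _).symm, Finset.filter_false,
      Finset.prod_empty, add_comm]
  · rw [if_neg (by tauto), if_neg (by tauto)]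

theorem statement12
    (Cbar : AddSubmonoid G)
    (hC : ∀ x ∈ Cbar, ∀ y ∈ Cbar, x + y = 0 → x = 0 ∧ y = 0)
    (χ : G → G → ℤ)
    (hχ₁ : ∀ x y z : G, χ (x + y) z = χ x z + χ y z)
    (hχ₂ : ∀ x y z : G, χ x (y + z) = χ x y + χ x z)
    (l u : Λˣ) (hl : ∀ k : ℕ, 0 < k → IsUnit ((l : Λ) ^ k - 1))
    (hu : (u : Λ) = (l : Λ) - 1)
    (Λ₀ : Subalgebra ℚ Λ)
    (h₀l : (l : Λ) ∈ Λ₀) (h₀linv : ((l⁻¹ : Λˣ) : Λ) ∈ Λ₀)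
    (h₀geom : ∀ k : ℕ, 0 < k → ∃ v ∈ Λ₀, v * (∑ i ∈ Finset.range (k + 1), (l : Λ) ^ i) = 1)
    (h₀not : ¬∃ v ∈ Λ₀, v * ((l : Λ) - 1) = 1) :
    (∀ (a b c : ℕ) (κ : Fin a → Cpos Cbar) (lam : Fin b → Cpos Cbar) (μ : Fin c → Cpos Cbar),
      coeff614 χ l u κ lam μ ∈ Λ₀) ∧
    (∀ f g : Multiset (Cpos Cbar) →₀ Λ, (∀ m, f m ∈ Λ₀) → (∀ m, g m ∈ Λ₀) →
      ∀ m, mulB χ l u hC f g m ∈ Λ₀) ∧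
    (∀ f g : Multiset (Cpos Cbar) →₀ Λ,
      (∀ m, f m ∈ Λ₀) → (∀ m, g m ∈ Λ₀) →
      (∀ m, f m ≠ 0 → Multiset.card m = 1) → (∀ m, g m ≠ 0 → Multiset.card m = 1) →
      (∀ m, (mulB χ l u hC f g - mulB χ l u hC g f) m ∈ Λ₀) ∧
      (∀ m, (mulB χ l u hC f g - mulB χ l u hC g f) m ≠ 0 → Multiset.card m = 1)) := by
  have hcoeff : ∀ (a b c : ℕ) (κ : Fin a → Cpos Cbar) (lam : Fin b → Cpos Cbar)
      (μ : Fin c → Cpos Cbar), coeff614 χ l u κ lam μ ∈ Λ₀ :=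
    fun a b c κ lam μ => coeff614_mem χ l u hu Λ₀ h₀l h₀linv κ lam μ
  have hmul : ∀ f g : Multiset (Cpos Cbar) →₀ Λ, (∀ m, f m ∈ Λ₀) → (∀ m, g m ∈ Λ₀) →
      ∀ m, mulB χ l u hC f g m ∈ Λ₀ := by
    intro f g hf hg m
    rw [mulB_apply]
    refine Λ₀.sum_mem fun m₁ _ => Λ₀.sum_mem fun m₂ _ => ?_
    split_ifs
    · exact Λ₀.mul_mem (Λ₀.mul_mem (hf m₁) (hg m₂)) (hcoeff _ _ _ _ _ _)
    · exact Λ₀.zero_mem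
  refine ⟨hcoeff, hmul, fun f g hf hg hf1 hg1 => ⟨fun m => ?_, fun m hm => ?_⟩⟩
  · rw [Finsupp.sub_apply]
    exact Λ₀.sub_mem (hmul f g hf hg m) (hmul g f hg hf m)
  · by_contra hc
    apply hm
    rw [Finsupp.sub_apply, sub_eq_zero, mulB_apply, mulB_apply, Finset.sum_comm]
    refine Finset.sum_congr rfl fun m₂ h₂ => Finset.sum_congr rfl fun m₁ h₁ => ?_
    rw [coeff614_comm χ l u (hf1 m₁ (Finsupp.mem_support_iff.1 h₁))
      (hg1 m₂ (Finsupp.mem_support_iff.1 h₂)) hc, mul_comm (f m₁)]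
    simp only [mem_candidatesB_comm hC (repF m₁) (repF m₂) m]

end
end
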